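/- Let M be a locally compact Hausdorff space and let ((B¹_m)_{m∈M}, Δ¹) and ((B²_m)_{m∈M}, Δ²) be continuous fields of Banach spaces over M, with total spaces B¹ and B² each carrying the topology generated by the respective sets U(ε,ξ,V). Let (Ψ_m : B¹_m → B²_m)_{m∈M} be a family of bounded ℂ-linear maps. Then the induced map B¹ → B², (m,b) ↦ (m, Ψ_m(b)), is continuous if and only if both of the following hold: (a) for every ξ ∈ Δ¹ the section m ↦ Ψ_m(ξ(m)) belongs to Δ²; (b) the function m ↦ ‖Ψ_m‖ (operator norm) is locally bounded on M. -/

import Mathlib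

noncomputable section

open Filter Topology

/-- A continuous field of Banach spaces over `M`: a family of complex Banach spaces
`(B m)` together with a `ℂ`-linear subspace `Δ` of sections satisfying Dixmier--Douady's
axioms (fullness of evaluation, norms in `C₀(M)`, local uniform closedness). -/
structure CtsFieldBanach (M : Type*) [TopologicalSpace M]
    (B : M → Type*) [∀ m, NormedAddCommGroup (B m)] [∀ m, NormedSpace ℂ (B m)]
    [∀ m, CompleteSpace (B m)] where
  Δ : Submodule ℂ (∀ m, B m)
  sect_surj : ∀ (m : M) (b : B m), ∃ ξ ∈ Δ, ξ m = b
  norm_cont : ∀ ξ ∈ Δ, Continuous fun m => ‖ξ m‖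
  norm_zeroAtInfty : ∀ ξ ∈ Δ, Tendsto (fun m => ‖ξ m‖) (cocompact M) (𝓝 0)
  locUnifClosed : ∀ ξ : (∀ m, B m),
    (∀ ε > (0 : ℝ), ∀ m : M, ∃ η ∈ Δ, ∃ V ∈ 𝓝 m, ∀ n ∈ V, ‖ξ n - η n‖ < ε) → ξ ∈ Δ

/-- The basic set `U(ε, ξ, V)` in the total space `Σ m, B m`. -/
def fieldU {M : Type*} [TopologicalSpace M] {B : M → Type*}
    [∀ m, NormedAddCommGroup (B m)] (ε : ℝ) (ξ : ∀ m, B m) (V : Set M) :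
    Set (Σ m, B m) :=
  {x | x.1 ∈ V ∧ ‖x.2 - ξ x.1‖ < ε}

/-- The topology on the total space `Σ m, B m` generated by the sets `U(ε, ξ, V)`
for `ε > 0`, `ξ ∈ Δ` and `V ⊆ M` open. -/
def fieldTopology {M : Type*} [TopologicalSpace M] {B : M → Type*}
    [∀ m, NormedAddCommGroup (B m)] (Δ : Set (∀ m, B m)) :
    TopologicalSpace (Σ m, B m) :=
  TopologicalSpace.generateFrom
    {S | ∃ ε > (0 : ℝ), ∃ ξ ∈ Δ, ∃ V : Set M, IsOpen V ∧ S = fieldU ε ξ V}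

section

variable {M : Type*} [TopologicalSpace M] {B : M → Type*} [∀ m, NormedAddCommGroup (B m)]

theorem isOpen_fieldU {Δ : Set (∀ m, B m)} {ε : ℝ} (hε : 0 < ε) {ξ : ∀ m, B m} (hξ : ξ ∈ Δ)
    {V : Set M} (hV : IsOpen V) : IsOpen[fieldTopology Δ] (fieldU ε ξ V) :=
  TopologicalSpace.isOpen_generateFrom_of_mem ⟨ε, hε, ξ, hξ, V, hV, rfl⟩

/-- An open set of the total space containing a point of a section in `Δ` contains a tube of
constant radius around that section, locally over the base. -/
theorem CtsFieldBanach.exists_tube_subset [∀ m, NormedSpace ℂ (B m)] [∀ m, CompleteSpace (B m)]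
    (F : CtsFieldBanach M B) {S : Set (Σ m, B m)}
    (hS : IsOpen[fieldTopology (F.Δ : Set (∀ m, B m))] S) {ξ : ∀ m, B m} (hξ : ξ ∈ F.Δ) {m : M}
    (hm : (⟨m, ξ m⟩ : Σ m, B m) ∈ S) :
    ∃ δ > (0 : ℝ), ∀ᶠ n in 𝓝 m, ∀ b : B n, ‖b - ξ n‖ < δ → (⟨n, b⟩ : Σ m, B m) ∈ S := by
  induction hS with
  | basic S h =>
    obtain ⟨ε, -, η, hη, V, hV, rfl⟩ := h
    obtain ⟨hmV, hlt⟩ := hm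
    obtain ⟨r, hr, hrε⟩ := exists_between hlt
    have hcont := F.norm_cont _ (F.Δ.sub_mem hξ hη)
    refine ⟨ε - r, sub_pos.2 hrε, ?_⟩
    filter_upwards [hV.mem_nhds hmV, hcont.continuousAt.eventually_lt_const hr] with n hnV hnr b hb
    refine ⟨hnV, ?_⟩
    have htri := norm_sub_le_norm_sub_add_norm_sub b (ξ n) (η n)
    simp only [Pi.sub_apply] at hnr
    change ‖b - η n‖ < ε
    linarith
  | univ => exact ⟨1, one_pos, .of_forall fun _ _ _ => trivial⟩
  | inter S T _ _ ihS ihT =>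
    obtain ⟨δ, hδ, h⟩ := ihS hm.1
    obtain ⟨δ', hδ', h'⟩ := ihT hm.2
    refine ⟨min δ δ', lt_min hδ hδ', ?_⟩
    filter_upwards [h, h'] with n hn hn' b hb
    exact ⟨hn b (hb.trans_le (min_le_left _ _)), hn' b (hb.trans_le (min_le_right _ _))⟩
  | sUnion 𝒮 _ ih =>
    obtain ⟨S, hS, hmS⟩ := hm
    obtain ⟨δ, hδ, h⟩ := ih S hS hmS
    exact ⟨δ, hδ, h.mono fun n hn b hb => ⟨S, hS, hn b hb⟩⟩

end

/-- a fibrewise family of bounded operators induces a continuous map of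
total spaces iff it maps `Δ¹` into `Δ²` and has locally bounded operator norm. -/
theorem stmt_4 {M : Type*} [TopologicalSpace M] [LocallyCompactSpace M] [T2Space M]
    {B1 B2 : M → Type*}
    [∀ m, NormedAddCommGroup (B1 m)] [∀ m, NormedSpace ℂ (B1 m)] [∀ m, CompleteSpace (B1 m)]
    [∀ m, NormedAddCommGroup (B2 m)] [∀ m, NormedSpace ℂ (B2 m)] [∀ m, CompleteSpace (B2 m)]
    (F1 : CtsFieldBanach M B1) (F2 : CtsFieldBanach M B2)
    (Ψ : ∀ m, B1 m →L[ℂ] B2 m) :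
    @Continuous (Σ m, B1 m) (Σ m, B2 m)
        (fieldTopology (F1.Δ : Set (∀ m, B1 m))) (fieldTopology (F2.Δ : Set (∀ m, B2 m)))
        (fun x => ⟨x.1, Ψ x.1 x.2⟩) ↔
      ((∀ ξ ∈ F1.Δ, (fun m => Ψ m (ξ m)) ∈ F2.Δ) ∧
        ∀ m : M, ∃ V ∈ 𝓝 m, ∃ C : ℝ, ∀ n ∈ V, ‖Ψ n‖ ≤ C) := by
  constructor
  · intro hΨ
    refine ⟨fun ξ hξ => F2.locUnifClosed _ fun ε hε m => ?_, fun m => ?_⟩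
    · obtain ⟨η, hη, hηm⟩ := F2.sect_surj m (Ψ m (ξ m))
      obtain ⟨δ, hδ, h⟩ := F1.exists_tube_subset
        (continuous_def.1 hΨ _ (isOpen_fieldU hε hη isOpen_univ)) hξ (m := m)
        ⟨trivial, by simpa [hηm] using hε⟩
      exact ⟨η, hη, _, h, fun n hn => (hn (ξ n) (by simpa using hδ)).2⟩
    · obtain ⟨δ, hδ, h⟩ := F1.exists_tube_subset
        (continuous_def.1 hΨ _ (isOpen_fieldU one_pos F2.Δ.zero_mem isOpen_univ)) F1.Δ.zero_mem
        (m := m) ⟨trivial, by simp⟩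
      refine ⟨_, h, 2 / δ, fun n hn => ?_⟩
      refine ContinuousLinearMap.opNorm_le_of_shell hδ (by positivity) (c := (2 : ℂ)) (by simp)
        fun x hx hxδ => ?_
      have hΨx : ‖Ψ n x - 0‖ < 1 := (hn x (by simpa using hxδ)).2
      rw [sub_zero] at hΨx
      have hle : 1 ≤ 2 / δ * ‖x‖ := by
        rw [Complex.norm_ofNat, div_le_iff₀ two_pos] at hx
        rw [div_mul_eq_mul_div, one_le_div₀ hδ]
        linarith
      linarith
  · rintro ⟨hΔ, hbdd⟩
    refine continuous_generateFrom_iff.2 ?_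
    rintro _ ⟨ε, hε, η, hη, V, hV, rfl⟩
    refine (@isOpen_iff_forall_mem_open _ (fieldTopology (F1.Δ : Set (∀ m, B1 m))) _).2 ?_
    rintro ⟨m, b⟩ ⟨hmV, hlt⟩
    obtain ⟨ξ, hξ, rfl⟩ := F1.sect_surj m b
    obtain ⟨W, hW, C, hC⟩ := hbdd m
    obtain ⟨r, hr, hrε⟩ := exists_between hlt
    have hcont := F2.norm_cont _ (F2.Δ.sub_mem (hΔ ξ hξ) hη)
    have hev := hcont.continuousAt.eventually_lt_const hr
    obtain ⟨O, hOsub, hO, hmO⟩ := mem_nhds_iff.1 (inter_mem hW (inter_mem hev (hV.mem_nhds hmV)))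
    have hC0 : 0 ≤ C := (norm_nonneg _).trans (hC m (mem_of_mem_nhds hW))
    have hC1 : 0 < C + 1 := by linarith
    have hδ : 0 < (ε - r) / (C + 1) := div_pos (sub_pos.2 hrε) hC1
    refine ⟨fieldU ((ε - r) / (C + 1)) ξ O, ?_, isOpen_fieldU hδ hξ hO, hmO, by simpa using hδ⟩
    rintro ⟨n, c⟩ ⟨hnO, hc⟩
    obtain ⟨hnW, hnr, hnV⟩ := hOsub hnO
    refine ⟨hnV, ?_⟩
    change ‖Ψ n (ξ n) - η n‖ < r at hnr
    change ‖c - ξ n‖ < _ at hc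
    change ‖Ψ n c - η n‖ < ε
    have hop : ‖Ψ n c - Ψ n (ξ n)‖ ≤ C * ‖c - ξ n‖ := by
      rw [← map_sub]
      exact (Ψ n).le_of_opNorm_le (hC n hnW) _
    have htri := norm_sub_le_norm_sub_add_norm_sub (Ψ n c) (Ψ n (ξ n)) (η n)
    rw [lt_div_iff₀ hC1] at hc
    nlinarith [norm_nonneg (c - ξ n)]
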